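/- arXiv:0905.1280 — 2 statements merged into one kernel-verified Lean document; each statement's English description precedes it below -/
import Mathlib

section
/- Let w ∈ W be a θ-twisted involution. Then there exist a spherical subset I ⊆ S with θ(I) = I, a natural number h, and s₁, …, s_h ∈ S such that w = s₁⋯s_h · w_I · θ(s_h)⋯θ(s₁) and ℓ(w) = ℓ(w_I) + 2h. -/
namespace CoxeterSystem

variable {B W : Type*} [Group W] {M : CoxeterMatrix B} (cs : CoxeterSystem M W)

open Classical in
/-- The action of a simple reflection on pairs consisting of a (potential) reflection and a sign:
conjugate the reflection, and flip the sign when it is the simple reflection itself. -/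
noncomputable def signedConj (i : B) : Function.End (W × ZMod 2) :=
  fun p => (cs.simple i * p.1 * cs.simple i, p.2 + if p.1 = cs.simple i then 1 else 0)

open Classical in
theorem signedConj_mul_pow_apply (i j : B) (m : ℕ) (x : W) (e : ZMod 2) :
    ((cs.signedConj i * cs.signedConj j) ^ m) (x, e) =
      ((cs.simple i * cs.simple j) ^ m * x * ((cs.simple i * cs.simple j) ^ m)⁻¹,
        e + ∑ n ∈ Finset.range (2 * m),
          if x = cs.simple j * (cs.simple i * cs.simple j) ^ n then 1 else 0) := by
  set r := cs.simple i * cs.simple j with hr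
  have hconj (k : ℕ) : cs.simple j * r ^ k = (r ^ k)⁻¹ * cs.simple j := by
    have h : cs.simple j * r * (cs.simple j)⁻¹ = r⁻¹ := by
      simp [hr, mul_assoc]
    rw [← inv_pow, ← h, conj_pow]
    simp
  induction m with
  | zero => simp [Function.End.one_def]
  | succ m ih =>
    rw [pow_succ']
    change cs.signedConj i (cs.signedConj j (((cs.signedConj i * cs.signedConj j) ^ m) (x, e))) = _
    rw [ih, show 2 * (m + 1) = 2 * m + 1 + 1 by ring, Finset.sum_range_succ,
      Finset.sum_range_succ]
    have hiff (a : ℕ) : r ^ m * x * (r ^ m)⁻¹ = cs.simple j * r ^ a ↔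
        x = cs.simple j * r ^ (2 * m + a) := by
      rw [show 2 * m + a = m + (a + m) by ring, pow_add r m, ← mul_assoc, hconj m, pow_add,
        mul_inv_eq_iff_eq_mul, ← eq_inv_mul_iff_mul_eq]
      simp only [mul_assoc]
    have h₁ : r ^ m * x * (r ^ m)⁻¹ = cs.simple j ↔ x = cs.simple j * r ^ (2 * m) := by
      simpa using hiff 0
    have h₂ : cs.simple j * (r ^ m * x * (r ^ m)⁻¹) * cs.simple j = cs.simple i ↔
        x = cs.simple j * r ^ (2 * m + 1) := by
      rw [← hiff 1, pow_one, hr, ← eq_mul_inv_iff_mul_eq, ← eq_inv_mul_iff_mul_eq, inv_simple]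
    simp only [signedConj, h₁, h₂]
    refine Prod.ext ?_ ?_
    · simp [pow_succ', hr, mul_assoc]
    · simp only [add_assoc]

theorem isLiftable_signedConj : M.IsLiftable cs.signedConj := by
  classical
  intro i j
  funext ⟨x, e⟩
  rw [signedConj_mul_pow_apply, cs.simple_mul_simple_pow, two_mul, Finset.sum_range_add]
  simp only [pow_add, cs.simple_mul_simple_pow, one_mul, CharTwo.add_self_eq_zero, inv_one, mul_one,
    add_zero]
  rfl

/-- The action of a Coxeter group on pairs of a (potential) reflection and a sign. -/
noncomputable def signedConjHom : W →* Function.End (W × ZMod 2) :=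
  cs.lift ⟨cs.signedConj, cs.isLiftable_signedConj⟩

open Classical in
theorem signedConjHom_wordProd_apply (ω : List B) (x : W) (e : ZMod 2) :
    cs.signedConjHom (cs.wordProd ω) (x, e) =
      (cs.wordProd ω * x * (cs.wordProd ω)⁻¹, e + ((cs.rightInvSeq ω).count x : ZMod 2)) := by
  induction ω with
  | nil => simp; rfl
  | cons i ω ih =>
    rw [wordProd_cons, map_mul]
    change cs.signedConjHom (cs.simple i) (cs.signedConjHom (cs.wordProd ω) (x, e)) = _
    rw [ih, signedConjHom, lift_apply_simple]
    have h : cs.wordProd ω * x * (cs.wordProd ω)⁻¹ = cs.simple i ↔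
        (cs.wordProd ω)⁻¹ * cs.simple i * cs.wordProd ω = x := by
      constructor
      · intro h
        simp [← h, mul_assoc]
      · intro h
        simp [← h, mul_assoc]
    simp only [signedConj, rightInvSeq, List.count_cons, beq_iff_eq, h]
    refine Prod.ext ?_ ?_
    · simp [mul_assoc]
    · push_cast
      simp only [add_assoc]

theorem simple_mem_rightInvSeq {ω : List B} {i : B}
    (h : cs.IsRightDescent (cs.wordProd ω) i) : cs.simple i ∈ cs.rightInvSeq ω := by
  classical
  obtain ⟨ω', hω', hprod⟩ := cs.exists_isReduced (cs.wordProd ω * cs.simple i)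
  have hnot : cs.simple i ∉ cs.rightInvSeq ω' := by
    intro hmem
    have h' := (cs.isRightInversion_of_mem_rightInvSeq hω' hmem).2
    rw [← hprod, simple_mul_simple_cancel_right] at h'
    exact lt_asymm h h'
  have heq : cs.wordProd ω = cs.wordProd (ω' ++ [i]) := by
    simp [wordProd_append, ← hprod]
  have hcount := cs.signedConjHom_wordProd_apply ω (cs.simple i) 0
  rw [heq, signedConjHom_wordProd_apply, ← heq] at hcount
  have hcount := congrArg Prod.snd hcount
  rw [← List.concat_eq_append, rightInvSeq_concat, List.concat_eq_append, List.count_append]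
    at hcount
  have hzero : (List.map (MulAut.conj (cs.simple i)) (cs.rightInvSeq ω')).count
      (cs.simple i) = 0 := by
    rw [List.count_eq_zero, List.mem_map]
    rintro ⟨y, hy, hyi⟩
    have : y = cs.simple i := by
      simpa [mul_assoc, mul_eq_one_iff_eq_inv] using hyi
    exact hnot (this ▸ hy)
  by_contra hmem
  rw [hzero, List.count_eq_zero_of_not_mem hmem] at hcount
  simp at hcount

theorem simple_mem_leftInvSeq {ω : List B} {i : B}
    (h : cs.IsLeftDescent (cs.wordProd ω) i) : cs.simple i ∈ cs.leftInvSeq ω := by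
  rw [← isRightDescent_inv_iff, ← wordProd_reverse] at h
  simpa [rightInvSeq_reverse] using cs.simple_mem_rightInvSeq h

/-- The exchange property. -/
theorem exists_simple_mul_wordProd_eq_eraseIdx {ω : List B} {i : B}
    (h : cs.IsLeftDescent (cs.wordProd ω) i) :
    ∃ k < ω.length, cs.simple i * cs.wordProd ω = cs.wordProd (ω.eraseIdx k) := by
  obtain ⟨k, hk, hki⟩ := List.getElem_of_mem (cs.simple_mem_leftInvSeq h)
  refine ⟨k, by simpa using hk, ?_⟩
  rw [← cs.getD_leftInvSeq_mul_wordProd, List.getD_eq_getElem _ _ hk, hki]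

theorem isLeftDescent_of_simple_mem {w : W} {i : B}
    (h : cs.simple i ∈ {s | ∃ i, s = cs.simple i ∧ cs.IsLeftDescent w i}) :
    cs.IsLeftDescent w i := by
  obtain ⟨j, hij, hj⟩ := h
  rwa [IsLeftDescent, hij]

theorem finite_setOf_isLeftDescent (w : W) :
    {s | ∃ i, s = cs.simple i ∧ cs.IsLeftDescent w i}.Finite := by
  obtain ⟨ω, rfl⟩ := cs.wordProd_surjective w
  refine (List.finite_toSet (cs.leftInvSeq ω)).subset ?_
  rintro _ ⟨i, rfl, hi⟩
  exact cs.simple_mem_leftInvSeq hi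

/-- If a letter on either side shortens `w` but both together do not shorten it by two, then
they act on `w` in the same way. -/
theorem simple_mul_eq_mul_simple {w : W} {i j : B} (hi : cs.IsLeftDescent w i)
    (hj : cs.IsRightDescent w j) (hij : cs.length w ≤ cs.length (cs.simple i * w * cs.simple j)) :
    cs.simple i * w = w * cs.simple j := by
  obtain ⟨ω, hω, hprod⟩ := cs.exists_isReduced (w * cs.simple j)
  have hw : w = cs.wordProd (ω ++ [j]) := by simp [wordProd_append, ← hprod]
  have hlen : ω.length < cs.length w := by
    rw [← hω.eq, ← hprod]
    exact hj
  rw [hw] at hi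
  obtain ⟨k, hk, hex⟩ := cs.exists_simple_mul_wordProd_eq_eraseIdx hi
  rw [← hw] at hex
  rcases lt_or_ge k ω.length with hlt | hge
  · rw [List.eraseIdx_append_of_lt_length hlt, wordProd_append, wordProd_singleton] at hex
    rw [hex, simple_mul_simple_cancel_right] at hij
    have := cs.length_wordProd_le (ω.eraseIdx k)
    have := List.length_eraseIdx_le ω k
    omega
  · have hkeq : k = ω.length := by
      simp at hk
      omega
    rw [hex, hprod, hkeq, List.eraseIdx_append_of_length_le le_rfl]
    simp

theorem exists_isReduced_of_mem_closure {I : Set W} (hI : I ⊆ Set.range cs.simple) {u : W}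
    (hu : u ∈ Subgroup.closure I) :
    ∃ ω : List B, cs.IsReduced ω ∧ u = cs.wordProd ω ∧ ∀ i ∈ ω, cs.simple i ∈ I := by
  have hstep (s : W) (hs : s ∈ I) (v : W)
      (hv : ∃ ω : List B, cs.IsReduced ω ∧ v = cs.wordProd ω ∧ ∀ i ∈ ω, cs.simple i ∈ I) :
      ∃ ω : List B, cs.IsReduced ω ∧ s * v = cs.wordProd ω ∧ ∀ i ∈ ω, cs.simple i ∈ I := by
    obtain ⟨i, rfl⟩ := hI hs
    obtain ⟨ω, hω, rfl, hωI⟩ := hv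
    by_cases hd : cs.IsLeftDescent (cs.wordProd ω) i
    · obtain ⟨k, hk, hex⟩ := cs.exists_simple_mul_wordProd_eq_eraseIdx hd
      refine ⟨ω.eraseIdx k, ?_, hex, fun j hj => hωI j (List.mem_of_mem_eraseIdx hj)⟩
      rw [IsReduced, ← hex, List.length_eraseIdx_of_lt hk]
      have := cs.isLeftDescent_iff.1 hd
      have := hω.eq
      omega
    · refine ⟨i :: ω, ?_, (cs.wordProd_cons i ω).symm, by simpa using ⟨hs, hωI⟩⟩
      rw [IsReduced, wordProd_cons, cs.not_isLeftDescent_iff.1 hd, hω.eq, List.length_cons]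
  induction hu using Subgroup.closure_induction_left with
  | one => exact ⟨[], by simp [IsReduced], by simp, by simp⟩
  | mul_left s hs v _ ih => exact hstep s hs v ih
  | inv_mul_cancel s hs v _ ih =>
    obtain ⟨i, rfl⟩ := hI hs
    rw [inv_simple]
    exact hstep _ hs v ih

/-- If every element of `I` is a left descent of `w`, then every element of the parabolic subgroup
generated by `I` is a prefix of `w`. -/
theorem length_add_length_inv_mul {I : Set W} (hI : I ⊆ Set.range cs.simple) {w : W}
    (hdesc : ∀ i, cs.simple i ∈ I → cs.IsLeftDescent w i) {u : W}
    (hu : u ∈ Subgroup.closure I) : cs.length u + cs.length (u⁻¹ * w) = cs.length w := by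
  obtain ⟨ω, hω, rfl, hωI⟩ := cs.exists_isReduced_of_mem_closure hI hu
  clear hu
  induction ω with
  | nil => simp
  | cons i ω ih =>
    have hω' : cs.IsReduced ω := hω.drop 1
    have ih := ih hω' fun j hj => hωI j (List.mem_cons_of_mem _ hj)
    obtain ⟨ω₂, hω₂, hprod⟩ := cs.exists_isReduced ((cs.wordProd ω)⁻¹ * w)
    have hw : w = cs.wordProd (ω ++ ω₂) := by simp [wordProd_append, ← hprod]
    have hd := hdesc i (hωI i List.mem_cons_self)
    rw [hw] at hd
    obtain ⟨k, hk, hex⟩ := cs.exists_simple_mul_wordProd_eq_eraseIdx hd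
    rw [hprod, hω'.eq, hω₂.eq] at ih
    have hωi := hω.eq
    rw [List.length_cons] at hωi
    have hge := cs.length_mul_le (cs.wordProd (i :: ω)) ((cs.wordProd (i :: ω))⁻¹ * w)
    rw [mul_inv_cancel_left] at hge
    rcases lt_or_ge k ω.length with hlt | hge'
    · rw [List.eraseIdx_append_of_lt_length hlt, wordProd_append, wordProd_append, ← mul_assoc,
        mul_left_inj, ← wordProd_cons] at hex
      have h := cs.length_wordProd_le (ω.eraseIdx k)
      rw [← hex, hωi, List.length_eraseIdx_of_lt hlt] at h
      omega
    · rw [List.eraseIdx_append_of_length_le hge', wordProd_append _ ω (ω₂.eraseIdx _), ← hw] at hex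
      have hshort : (cs.wordProd (i :: ω))⁻¹ * w =
          cs.wordProd (ω₂.eraseIdx (k - ω.length)) := by
        rw [wordProd_cons, mul_inv_rev, inv_simple, mul_assoc, hex, inv_mul_cancel_left]
      have h := cs.length_wordProd_le (ω₂.eraseIdx (k - ω.length))
      rw [List.length_append] at hk
      rw [← hshort, List.length_eraseIdx_of_lt (by omega)] at h
      omega

theorem finite_closure_of_length_le {I : Set W} (hI : I ⊆ Set.range cs.simple) (hfin : I.Finite)
    {n : ℕ} (hn : ∀ u ∈ Subgroup.closure I, cs.length u ≤ n) :
    (Subgroup.closure I : Set W).Finite := by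
  have := hfin.to_subtype
  refine ((List.finite_length_le I n).image fun l => (l.map Subtype.val).prod).subset ?_
  intro u hu
  obtain ⟨ω, hω, rfl, hωI⟩ := cs.exists_isReduced_of_mem_closure hI hu
  refine ⟨ω.attach.map fun i => ⟨cs.simple i.1, hωI i.1 i.2⟩, ?_, ?_⟩
  · simpa [← hω.eq] using hn _ hu
  · simp [wordProd, Function.comp_def]

theorem simple_mem_of_mem_closure {I : Set W} (hI : I ⊆ Set.range cs.simple) {i : B}
    (hi : cs.simple i ∈ Subgroup.closure I) : cs.simple i ∈ I := by
  obtain ⟨ω, hω, hprod, hωI⟩ := cs.exists_isReduced_of_mem_closure hI hi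
  have hlen : ω.length = 1 := by rw [← hω.eq, ← hprod, length_simple]
  obtain ⟨j, rfl⟩ := List.length_eq_one_iff.1 hlen
  rw [hprod, wordProd_singleton]
  exact hωI j (by simp)

theorem length_map_le (θ : W ≃* W) (hθ : ∀ i, ∃ j, θ (cs.simple i) = cs.simple j) (u : W) :
    cs.length (θ u) ≤ cs.length u := by
  choose f hf using hθ
  obtain ⟨ω, hω, rfl⟩ := cs.exists_isReduced u
  have h : θ (cs.wordProd ω) = cs.wordProd (ω.map f) := by
    simp [wordProd, map_list_prod, Function.comp_def, hf]
  rw [h, hω.eq, ← List.length_map f]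
  exact cs.length_wordProd_le _

/-- If right multiplication of `w` by any right descent agrees with left multiplication by some left
descent, then `w` lies in the parabolic subgroup generated by its left descents. -/
theorem mem_closure_isLeftDescent {w : W}
    (hR : ∀ j, cs.IsRightDescent w j →
      ∃ i, cs.IsLeftDescent w i ∧ cs.simple i * w = w * cs.simple j) :
    w ∈ Subgroup.closure {s | ∃ i, s = cs.simple i ∧ cs.IsLeftDescent w i} := by
  set I : Set W := {s | ∃ i, s = cs.simple i ∧ cs.IsLeftDescent w i}
  have hI : I ⊆ Set.range cs.simple := by
    rintro _ ⟨i, rfl, -⟩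
    exact ⟨i, rfl⟩
  have hsplit {u : W} (hu : u ∈ Subgroup.closure I) :=
    cs.length_add_length_inv_mul hI (fun i hi => cs.isLeftDescent_of_simple_mem hi) hu
  have hfin : (Subgroup.closure I : Set W).Finite :=
    cs.finite_closure_of_length_le hI (cs.finite_setOf_isLeftDescent w) fun u hu =>
      (Nat.le_add_right _ _).trans (hsplit hu).le
  obtain ⟨a, ha, hmax⟩ := Set.exists_max_image _ cs.length hfin ⟨1, Subgroup.one_mem _⟩
  by_cases hv : a⁻¹ * w = 1
  · rwa [← inv_mul_eq_one.1 hv]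
  obtain ⟨j, hj⟩ := cs.exists_rightDescent_of_ne_one hv
  have hwj : cs.IsRightDescent w j := by
    have h := cs.length_mul_le a (a⁻¹ * w * cs.simple j)
    rw [mul_assoc, mul_inv_cancel_left, ← mul_assoc] at h
    have h₁ := hsplit ha
    have h₂ : cs.length (a⁻¹ * w * cs.simple j) < cs.length (a⁻¹ * w) := hj
    change cs.length (w * cs.simple j) < cs.length w
    omega
  obtain ⟨i, hi, hij⟩ := hR j hwj
  have hia : cs.simple i * a ∈ Subgroup.closure I :=
    Subgroup.mul_mem _ (Subgroup.subset_closure ⟨i, rfl, hi⟩) ha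
  have h₁ := hsplit hia
  have h₂ := hsplit ha
  have h₃ := hmax _ hia
  have h₄ : cs.length (a⁻¹ * w * cs.simple j) < cs.length (a⁻¹ * w) := hj
  rw [mul_inv_rev, inv_simple, mul_assoc, hij, ← mul_assoc] at h₁
  omega

end CoxeterSystem

/-- Let `(W,S)` be a Coxeter system with length function `ℓ`, and let `θ` be an automorphism
of `W` with `θ(S) = S` and `θ ∘ θ = id`.  If `w` is a `θ`-twisted involution (`θ(w) = w⁻¹`),
then there exist a `θ`-stable spherical subset `I ⊆ S` (i.e. `θ(I) = I` and `⟨I⟩` is finite)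
and `s₁, …, s_h ∈ S` such that `w = s₁⋯s_h ⬝ w_I ⬝ θ(s_h)⋯θ(s₁)` and
`ℓ(w) = ℓ(w_I) + 2h`, where `w_I` is the longest element of `(⟨I⟩, I)`. -/
theorem twisted_involution_decomposition
    {B W : Type*} [Group W] {M : CoxeterMatrix B} (cs : CoxeterSystem M W)
    (θ : W ≃* W) (hθS : ⇑θ '' Set.range cs.simple = Set.range cs.simple)
    (hθ2 : ∀ u : W, θ (θ u) = u)
    (w : W) (hw : θ w = w⁻¹) :
    ∃ (I : Set W) (wI : W) (L : List W),
      I ⊆ Set.range cs.simple ∧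
      ⇑θ '' I = I ∧
      (Subgroup.closure I : Set W).Finite ∧
      wI ∈ Subgroup.closure I ∧
      (∀ u ∈ Subgroup.closure I, cs.length u ≤ cs.length wI) ∧
      (∀ x ∈ L, x ∈ Set.range cs.simple) ∧
      w = L.prod * wI * ((L.map θ).reverse).prod ∧
      cs.length w = cs.length wI + 2 * L.length := by
  have hθ (i : B) : ∃ j, θ (cs.simple i) = cs.simple j := by
    obtain ⟨j, hj⟩ := hθS.subset ⟨_, ⟨i, rfl⟩, rfl⟩
    exact ⟨j, hj.symm⟩
  have hlen (u : W) : cs.length (θ u) = cs.length u := by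
    refine le_antisymm (cs.length_map_le θ hθ u) ?_
    simpa [hθ2] using cs.length_map_le θ hθ (θ u)
  have hdesc {w : W} (hw : θ w = w⁻¹) {i j : B} (hij : θ (cs.simple i) = cs.simple j) :
      cs.IsRightDescent w j ↔ cs.IsLeftDescent w i := by
    rw [← cs.isLeftDescent_inv_iff, CoxeterSystem.IsLeftDescent, CoxeterSystem.IsLeftDescent,
      cs.length_inv, ← hw, ← hij, ← map_mul, hlen]
  induction hn : cs.length w using Nat.strong_induction_on generalizing w with
  | _ n ih =>
  subst hn
  by_cases hred : ∃ i, cs.IsLeftDescent w i ∧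
      cs.length (cs.simple i * w * θ (cs.simple i)) < cs.length w
  · obtain ⟨i, hi, hlt⟩ := hred
    obtain ⟨j, hj⟩ := hθ i
    have hj' : θ (cs.simple j) = cs.simple i := by rw [← hj, hθ2]
    obtain ⟨I, wI, L, hI, hθI, hfin, hwI, hmax, hL, hprod, hlenw⟩ :=
      ih _ hlt (cs.simple i * w * θ (cs.simple i)) (by simp [hw, hj, hj', mul_assoc]) rfl
    refine ⟨I, wI, cs.simple i :: L, hI, hθI, hfin, hwI, hmax, ?_, ?_, ?_⟩
    · simpa using hL
    · have h : w = cs.simple i * (cs.simple i * w * θ (cs.simple i)) * θ (cs.simple i) := by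
        simp [hj, mul_assoc]
      rw [h, hprod]
      simp [mul_assoc]
    · have h₁ := cs.isLeftDescent_iff.1 hi
      rw [hj] at hlt hlenw
      have h₂ := cs.length_mul_simple (cs.simple i * w) j
      rw [List.length_cons]
      omega
  · push Not at hred
    have hcomm {i j : B} (hij : θ (cs.simple i) = cs.simple j) (hi : cs.IsLeftDescent w i) :
        cs.simple i * w = w * cs.simple j :=
      cs.simple_mul_eq_mul_simple hi ((hdesc hw hij).2 hi) (hij ▸ hred i hi)
    set I : Set W := {s | ∃ i, s = cs.simple i ∧ cs.IsLeftDescent w i}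
    have hI : I ⊆ Set.range cs.simple := by
      rintro _ ⟨i, rfl, -⟩
      exact ⟨i, rfl⟩
    have hwI : w ∈ Subgroup.closure I := by
      refine cs.mem_closure_isLeftDescent fun j hj => ?_
      obtain ⟨i, hi⟩ := hθ j
      have hij : θ (cs.simple i) = cs.simple j := by rw [← hi, hθ2]
      have hdi := (hdesc hw hij).1 hj
      exact ⟨i, hdi, hcomm hij hdi⟩
    have hmax (u : W) (hu : u ∈ Subgroup.closure I) : cs.length u ≤ cs.length w :=
      (Nat.le_add_right _ _).trans (cs.length_add_length_inv_mul hI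
        (fun i hi => cs.isLeftDescent_of_simple_mem hi) hu).le
    have hθI (s : W) (hs : s ∈ I) : θ s ∈ I := by
      obtain ⟨i, rfl, hi⟩ := hs
      obtain ⟨j, hij⟩ := hθ i
      rw [hij]
      refine cs.simple_mem_of_mem_closure hI ?_
      rw [← inv_mul_cancel_left w (cs.simple j), ← hcomm hij hi]
      exact mul_mem (inv_mem hwI) (mul_mem (Subgroup.subset_closure ⟨i, rfl, hi⟩) hwI)
    refine ⟨I, w, [], hI, ?_, cs.finite_closure_of_length_le hI (cs.finite_setOf_isLeftDescent w)
      hmax, hwI, hmax, by simp, by simp, by simp⟩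
    exact Set.Subset.antisymm (Set.image_subset_iff.2 hθI) fun s hs => ⟨θ s, hθI s hs, hθ2 s⟩
end

section
/- Let c ∈ C_ε be a chamber with w := δ^θ(c) and let s ∈ S with ℓ(swθ(s)) = ℓ(w) + 2. Then there exists a unique chamber d ∈ P_s(c) with δ^θ(d) = swθ(s); moreover, for every x ∈ P_s(c) with x ≠ d and every e ∈ P_{θ(s)}(θ(c)), one has ℓ(δ*(x,e)) < ℓ(δ*(d,e)). -/
universe u v

/-- A twin building of type `(W,S)` (where `S` is the set of simple reflections of the
Coxeter system `cs`), with positive half `Cp` and negative half `Cm`, distance functions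
`δp`, `δm`, codistance `δst : Cp × Cm → W`, `δts : Cm × Cp → W`, together with a
quasi-flip: maps `θp : Cp → Cm`, `θm : Cm → Cp` inverse to each other and an automorphism
`π` of `W` with `π(S) = S`, `π ∘ π = id`, compatible with the distances and the
codistance. -/
structure QuasiFlipTwinBuilding {B : Type*} {W : Type*} [Group W]
    (M : CoxeterMatrix B) (cs : CoxeterSystem M W)
    (Cp : Type u) (Cm : Type v) where
  δp : Cp → Cp → W
  δm : Cm → Cm → W
  δst : Cp → Cm → W
  δts : Cm → Cp → W
  θp : Cp → Cm
  θm : Cm → Cp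
  π : W ≃* W
  nonempty_p : Nonempty Cp
  nonempty_m : Nonempty Cm
  /-- (Bu1) for the positive half -/
  p_eq_one_iff : ∀ x y : Cp, δp x y = 1 ↔ x = y
  /-- (Bu1) for the negative half -/
  m_eq_one_iff : ∀ x y : Cm, δm x y = 1 ↔ x = y
  /-- (Bu2) for the positive half -/
  p_two : ∀ (x y z : Cp) (s : W), s ∈ Set.range cs.simple → δp y z = s →
    δp x z = δp x y ∨ δp x z = δp x y * s
  p_two' : ∀ (x y z : Cp) (s : W), s ∈ Set.range cs.simple → δp y z = s →
    cs.length (δp x y * s) = cs.length (δp x y) + 1 → δp x z = δp x y * s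
  /-- (Bu2) for the negative half -/
  m_two : ∀ (x y z : Cm) (s : W), s ∈ Set.range cs.simple → δm y z = s →
    δm x z = δm x y ∨ δm x z = δm x y * s
  m_two' : ∀ (x y z : Cm) (s : W), s ∈ Set.range cs.simple → δm y z = s →
    cs.length (δm x y * s) = cs.length (δm x y) + 1 → δm x z = δm x y * s
  /-- (Bu3) for the positive half -/
  p_three : ∀ (x y : Cp) (s : W), s ∈ Set.range cs.simple →
    ∃ z : Cp, δp y z = s ∧ δp x z = δp x y * s
  /-- (Bu3) for the negative half -/
  m_three : ∀ (x y : Cm) (s : W), s ∈ Set.range cs.simple →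
    ∃ z : Cm, δm y z = s ∧ δm x z = δm x y * s
  /-- (Tw1) -/
  tw1 : ∀ (x : Cp) (y : Cm), δts y x = (δst x y)⁻¹
  /-- (Tw2), positive-to-negative -/
  tw2p : ∀ (x : Cp) (y z : Cm) (s : W), s ∈ Set.range cs.simple → δm y z = s →
    cs.length (δst x y * s) + 1 = cs.length (δst x y) → δst x z = δst x y * s
  /-- (Tw2), negative-to-positive -/
  tw2m : ∀ (x : Cm) (y z : Cp) (s : W), s ∈ Set.range cs.simple → δp y z = s →
    cs.length (δts x y * s) + 1 = cs.length (δts x y) → δts x z = δts x y * s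
  /-- (Tw3), positive-to-negative -/
  tw3p : ∀ (x : Cp) (y : Cm) (s : W), s ∈ Set.range cs.simple →
    ∃ z : Cm, δm y z = s ∧ δst x z = δst x y * s
  /-- (Tw3), negative-to-positive -/
  tw3m : ∀ (x : Cm) (y : Cp) (s : W), s ∈ Set.range cs.simple →
    ∃ z : Cp, δp y z = s ∧ δts x z = δts x y * s
  /-- `θ ∘ θ = id` -/
  θmθp : ∀ c : Cp, θm (θp c) = c
  θpθm : ∀ c : Cm, θp (θm c) = c
  /-- `π(S) = S` -/
  πS : ⇑π '' Set.range cs.simple = Set.range cs.simple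
  /-- `π ∘ π = id` -/
  ππ : ∀ w : W, π (π w) = w
  /-- `θ` interchanges the distances via `π` -/
  flip_p : ∀ x y : Cp, δm (θp x) (θp y) = π (δp x y)
  flip_m : ∀ x y : Cm, δp (θm x) (θm y) = π (δm x y)
  /-- `θ` preserves the codistance via `π` -/
  flip_st : ∀ (x : Cp) (z : Cm), δts (θp x) (θm z) = π (δst x z)
  flip_ts : ∀ (x : Cm) (z : Cp), δst (θm x) (θp z) = π (δts x z)

namespace QuasiFlipTwinBuilding

variable {B : Type*} {W : Type*} [Group W] {M : CoxeterMatrix B} {cs : CoxeterSystem M W}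
  {Cp : Type u} {Cm : Type v}

/-- The same twin building with a quasi-flip, with the roles of the two halves
interchanged. -/
def swap (T : QuasiFlipTwinBuilding M cs Cp Cm) : QuasiFlipTwinBuilding M cs Cm Cp where
  δp := T.δm
  δm := T.δp
  δst := T.δts
  δts := T.δst
  θp := T.θm
  θm := T.θp
  π := T.π
  nonempty_p := T.nonempty_m
  nonempty_m := T.nonempty_p
  p_eq_one_iff := T.m_eq_one_iff
  m_eq_one_iff := T.p_eq_one_iff
  p_two := T.m_two
  p_two' := T.m_two'
  m_two := T.p_two
  m_two' := T.p_two'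
  p_three := T.m_three
  m_three := T.p_three
  tw1 := fun x y => by rw [T.tw1 y x, inv_inv]
  tw2p := T.tw2m
  tw2m := T.tw2p
  tw3p := T.tw3m
  tw3m := T.tw3p
  θmθp := T.θpθm
  θpθm := T.θmθp
  πS := T.πS
  ππ := T.ππ
  flip_p := T.flip_m
  flip_m := T.flip_p
  flip_st := T.flip_ts
  flip_ts := T.flip_st

variable (T : QuasiFlipTwinBuilding M cs Cp Cm)

/-- The `θ`-codistance `δ^θ(c) = δ*(c, θ(c))` of a chamber of the positive half. -/
def δθ (c : Cp) : W := T.δst c (T.θp c)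

/-- The numerical `θ`-codistance `ℓ^θ(c) = ℓ(δ^θ(c))`. -/
noncomputable def ℓθ (c : Cp) : ℕ := cs.length (T.δθ c)

/-- The `s`-panel of a chamber `c`. -/
def panel (s : W) (c : Cp) : Set Cp := {d | T.δp c d = 1 ∨ T.δp c d = s}

/-- The `J`-residue of a chamber `c`. -/
def residue (J : Set W) (c : Cp) : Set Cp := {d | T.δp c d ∈ Subgroup.closure J}

/-- Opposition of chambers: `δ*(c,d) = 1`. -/
def Opp (c : Cp) (d : Cm) : Prop := T.δst c d = 1

/-- `R` is a Phan residue of type `J`: `R` is a `J`-residue, every chamber of `R` is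
opposite some chamber of `θ(R)`, and every chamber of `θ(R)` is opposite some chamber
of `R`. -/
def IsPhan (J : Set W) (R : Set Cp) : Prop :=
  (∃ c : Cp, R = T.residue J c) ∧
  (∀ r ∈ R, ∃ r' ∈ R, T.Opp r (T.θp r')) ∧
  (∀ r' ∈ R, ∃ r ∈ R, T.Opp r (T.θp r'))

/-- `R` is a minimal Phan residue of type `J`: it is a Phan residue containing no Phan
residue as a proper subset. -/
def IsMinPhan (J : Set W) (R : Set Cp) : Prop :=
  T.IsPhan J R ∧ ∀ (J' : Set W) (R' : Set Cp), J' ⊆ Set.range cs.simple →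
    T.IsPhan J' R' → R' ⊆ R → R' = R

/-- Two chambers are `J`-adjacent: they are `j`-adjacent for some `j ∈ J`. -/
def adjJ (J : Set W) (c d : Cp) : Prop := ∃ j ∈ J, T.δp c d = 1 ∨ T.δp c d = j

/-- There is a `J`-gallery from `c` to `d` all of whose chambers lie in `X`. -/
def GalleryIn (X : Set Cp) (J : Set W) (c d : Cp) : Prop :=
  ∃ γ : List Cp, γ.head? = some c ∧ γ.getLast? = some d ∧
    γ.Chain' (T.adjJ J) ∧ ∀ x ∈ γ, x ∈ X

/-- The flip-flop system of a set `R` of chambers: the chambers of `R` whose numerical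
`θ`-codistance is minimal among chambers of `R`. -/
def flipflop (R : Set Cp) : Set Cp := {c ∈ R | ∀ d ∈ R, T.ℓθ c ≤ T.ℓθ d}

/-- The flip-flop system `R^θ` is connected: any two of its chambers are joined by a
gallery all of whose chambers lie in `R^θ`. -/
def ConnectedFF (R : Set Cp) : Prop :=
  ∀ c ∈ T.flipflop R, ∀ d ∈ T.flipflop R,
    T.GalleryIn (T.flipflop R) (Set.range cs.simple) c d

/-- `R` admits direct descent into `R^θ`: from every chamber of `R` there is a gallery
within `R` ending in `R^θ` along which the numerical `θ`-codistance strictly decreases. -/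
def DirectDescent (R : Set Cp) : Prop :=
  ∀ c ∈ R, ∃ γ : List Cp, γ.head? = some c ∧
    (∃ e, γ.getLast? = some e ∧ e ∈ T.flipflop R) ∧
    γ.Chain' (T.adjJ (Set.range cs.simple)) ∧
    γ.Chain' (fun a b => T.ℓθ b < T.ℓθ a) ∧
    ∀ x ∈ γ, x ∈ R

/-- The quasi-flip is strong on this half: for every chamber `c` and every `s ∈ S` there
are chambers `d, x` in the `s`-panel of `c` with `ℓ(δ*(x, θ(d))) > ℓ(δ*(d, θ(d)))`,
i.e. the projection of `θ(d)` onto the panel is not `d`. -/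
def IsStrongHalf : Prop :=
  ∀ (c : Cp) (s : W), s ∈ Set.range cs.simple →
    ∃ d ∈ T.panel s c, ∃ x ∈ T.panel s c,
      cs.length (T.δst d (T.θp d)) < cs.length (T.δst x (T.θp d))

end QuasiFlipTwinBuilding

namespace QuasiFlipTwinBuilding

variable {B : Type*} {W : Type*} [Group W] {M : CoxeterMatrix B} {cs : CoxeterSystem M W}
  {Cp : Type u} {Cm : Type v} (T : QuasiFlipTwinBuilding M cs Cp Cm)

theorem simple_mul_self_of_mem {s : W} (hs : s ∈ Set.range cs.simple) : s * s = 1 := by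
  obtain ⟨i, rfl⟩ := hs
  exact cs.simple_mul_simple_self i

theorem ne_one_of_mem_simple {s : W} (hs : s ∈ Set.range cs.simple) : s ≠ 1 := by
  obtain ⟨i, rfl⟩ := hs
  intro h
  have := cs.length_simple i
  simp [h] at this

theorem length_mul_simple_le {s : W} (hs : s ∈ Set.range cs.simple) (w : W) :
    cs.length (w * s) ≤ cs.length w + 1 := by
  obtain ⟨i, rfl⟩ := hs
  simpa using cs.length_mul_le w (cs.simple i)

theorem length_simple_mul_le {s : W} (hs : s ∈ Set.range cs.simple) (w : W) :
    cs.length (s * w) ≤ cs.length w + 1 := by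
  obtain ⟨i, rfl⟩ := hs
  have := cs.length_mul_le (cs.simple i) w
  simp only [cs.length_simple] at this
  omega

/-- Adjacency of chambers is symmetric. -/
theorem δp_symm_of_eq_simple {s : W} (hs : s ∈ Set.range cs.simple) {c d : Cp}
    (h : T.δp c d = s) : T.δp d c = s := by
  have hdd : T.δp d d = 1 := (T.p_eq_one_iff d d).2 rfl
  rcases T.p_two d c d s hs h with h1 | h1
  · have hdc : d = c := (T.p_eq_one_iff d c).1 (h1.symm.trans hdd)
    exact absurd (h.symm.trans ((T.p_eq_one_iff c d).2 hdc.symm)) (ne_one_of_mem_simple hs)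
  · exact mul_right_cancel ((h1.symm.trans hdd).trans (simple_mul_self_of_mem hs).symm)

/-- Distinct chambers of an `s`-panel are at distance `s`. -/
theorem δp_eq_of_mem_panel {s : W} (hs : s ∈ Set.range cs.simple) {c x y : Cp}
    (hx : x ∈ T.panel s c) (hy : y ∈ T.panel s c) (hxy : x ≠ y) : T.δp x y = s := by
  rcases hx with hx | hx
  · obtain rfl := (T.p_eq_one_iff c x).1 hx
    exact hy.resolve_left fun h => hxy ((T.p_eq_one_iff _ _).1 h)
  · have hxc := T.δp_symm_of_eq_simple hs hx
    rcases hy with hy | hy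
    · obtain rfl := (T.p_eq_one_iff c y).1 hy
      exact hxc
    · rcases T.p_two x c y s hs hy with h | h
      · exact h.trans hxc
      · rw [hxc, simple_mul_self_of_mem hs] at h
        exact absurd ((T.p_eq_one_iff _ _).1 h) hxy

/-- If the codistance from `d` to `e` drops when multiplied by `s` on the left, then every
chamber `s`-adjacent to and distinct from `d` has the smaller codistance to `e`. -/
theorem δst_eq_simple_mul {s : W} (hs : s ∈ Set.range cs.simple) {d x : Cp} {e : Cm}
    (hdx : T.δp d x = s) (hlen : cs.length (s * T.δst d e) + 1 = cs.length (T.δst d e)) :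
    T.δst x e = s * T.δst d e := by
  have hinv : T.δts e d * s = (s * T.δst d e)⁻¹ := by
    rw [T.tw1, mul_inv_rev, inv_eq_of_mul_eq_one_left (simple_mul_self_of_mem hs)]
  have h := T.tw2m e d x s hs hdx (by rw [hinv, T.tw1, cs.length_inv, cs.length_inv, hlen])
  rw [hinv, T.tw1] at h
  exact inv_injective h

end QuasiFlipTwinBuilding

open QuasiFlipTwinBuilding in
/-- Let `c` be a chamber with `θ`-codistance `w := δ^θ(c)` and let `s ∈ S` with
`ℓ(swθ(s)) = ℓ(w) + 2`.  Then there exists a unique chamber `d` of the `s`-panel of `c`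
with `δ^θ(d) = swθ(s)`; moreover `ℓ(δ*(x,e)) < ℓ(δ*(d,e))` for all `x ∈ P_s(c) ∖ {d}`
and `e ∈ P_{θ(s)}(θ(c))`. -/
theorem steep_ascent_of_length_add_two
    {B : Type*} {W : Type*} [Group W] {M : CoxeterMatrix B} {cs : CoxeterSystem M W}
    {Cp : Type u} {Cm : Type v} (T : QuasiFlipTwinBuilding M cs Cp Cm)
    (c : Cp) (s : W) (hs : s ∈ Set.range cs.simple)
    (hlen : cs.length (s * T.δθ c * T.π s) = cs.length (T.δθ c) + 2) :
    ∃ d ∈ T.panel s c, T.δθ d = s * T.δθ c * T.π s ∧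
      (∀ d' ∈ T.panel s c, T.δθ d' = s * T.δθ c * T.π s → d' = d) ∧
      (∀ x ∈ T.panel s c, x ≠ d → ∀ e ∈ T.swap.panel (T.π s) (T.θp c),
        cs.length (T.δst x e) < cs.length (T.δst d e)) := by
  have ht : T.π s ∈ Set.range cs.simple := T.πS ▸ Set.mem_image_of_mem _ hs
  have hss := simple_mul_self_of_mem hs
  have htt := simple_mul_self_of_mem ht
  have hlsw : cs.length (s * T.δθ c) = cs.length (T.δθ c) + 1 := by
    have h1 := length_mul_simple_le ht (s * T.δθ c)
    have h2 := length_simple_mul_le hs (T.δθ c)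
    omega
  have hlwt : cs.length (T.δθ c * T.π s) = cs.length (T.δθ c) + 1 := by
    have h1 := length_simple_mul_le hs (T.δθ c * T.π s)
    have h2 := length_mul_simple_le ht (T.δθ c)
    rw [← mul_assoc] at h1
    omega
  obtain ⟨d, hcd, hd⟩ := T.tw3m (T.θp c) c s hs
  have hdc : T.δst d (T.θp c) = s * T.δθ c := by
    rw [T.tw1, T.tw1] at hd
    have := congrArg (·⁻¹) hd
    simpa [inv_eq_of_mul_eq_one_left hss, δθ] using this
  have hcθd : T.δst c (T.θp d) = T.δθ c * T.π s := by
    have h1 := T.flip_st c (T.θp c)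
    have h2 := T.flip_st d (T.θp c)
    rw [T.θmθp, T.tw1] at h1 h2
    rw [hdc, map_mul, δθ, ← h1] at h2
    have := congrArg (·⁻¹) h2
    simpa [inv_eq_of_mul_eq_one_left htt, δθ] using this
  have hdP : d ∈ T.panel s c := Or.inr hcd
  have hθ : ∀ x ∈ T.panel s c, T.θp x ∈ T.swap.panel (T.π s) (T.θp c) := by
    rintro x (hx | hx)
    · exact Or.inl ((T.flip_p c x).trans (by rw [hx, map_one]))
    · exact Or.inr ((T.flip_p c x).trans (by rw [hx]))
  obtain ⟨e₀, he₀, hde₀⟩ := T.tw3p d (T.θp c) (T.π s) ht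
  rw [hdc] at hde₀
  have hde : ∀ e ∈ T.swap.panel (T.π s) (T.θp c), e ≠ e₀ → T.δst d e = s * T.δθ c := by
    intro e he hne
    have h := T.swap.δp_eq_of_mem_panel ht (Or.inr he₀) he hne.symm
    have hmul : T.δst d e₀ * T.π s = s * T.δθ c := by rw [hde₀, mul_assoc, htt, mul_one]
    rw [T.tw2p d e₀ e (T.π s) ht h (by rw [hmul, hde₀, hlsw, hlen]), hmul]
  have hθd : T.θp d = e₀ := by
    by_contra hne
    have h1 := hde _ (hθ d hdP) hne
    have hmul : s * T.δst d (T.θp d) = T.δθ c := by rw [h1, ← mul_assoc, hss, one_mul]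
    have h2 := T.δst_eq_simple_mul hs (e := T.θp d) (T.δp_symm_of_eq_simple hs hcd)
      (by rw [hmul, h1, hlsw])
    rw [hmul, hcθd] at h2
    exact ne_one_of_mem_simple ht (mul_eq_left.1 h2)
  have hlt : ∀ x ∈ T.panel s c, x ≠ d → ∀ e ∈ T.swap.panel (T.π s) (T.θp c),
      cs.length (T.δst x e) < cs.length (T.δst d e) := by
    intro x hx hxd e he
    have hdx := T.δp_eq_of_mem_panel hs hdP hx hxd.symm
    have hdrop : cs.length (s * T.δst d e) + 1 = cs.length (T.δst d e) := by
      by_cases h : e = e₀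
      · rw [h, hde₀, hlen, ← mul_assoc, ← mul_assoc, hss, one_mul, hlwt]
      · rw [hde e he h, ← mul_assoc, hss, one_mul, hlsw]
    rw [T.δst_eq_simple_mul hs hdx hdrop]
    omega
  refine ⟨d, hdP, by rw [δθ, hθd, hde₀], fun d' hd' h => ?_, hlt⟩
  by_contra hne
  have h1 := hlt d' hd' hne _ (hθ d' hd')
  have h2 : T.θp d' ≠ e₀ := by
    rw [← hθd]
    exact fun h => hne (by rw [← T.θmθp d', h, T.θmθp])
  rw [hde _ (hθ d' hd') h2] at h1
  rw [δθ] at h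
  rw [h] at h1
  omega
end
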